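/- arXiv:2103.06839 — 4 statements merged into one kernel-verified Lean document; each statement's English description precedes it below -/
import Mathlib

section
/- Let α ∈ [0,1), γ ∈ ℝ \ {0}, and a ∈ (0,1). Set z₁ := 1, z₂ := 0, z₃ := −a, γ₁ := γ, γ₂ := −γ (a/(a+1))^{α+1}, and γ₃ := γ a^{α+1}. Then this tripole is a stationary point vortex configuration: for each j ∈ {1,2,3}, ∑_{k≠j} γ_k (z_j − z_k)/|z_j − z_k|^{α+2} = 0. -/
theorem rpow_add_two_eq_rpow_add_one_mul {x : ℝ} (hx : 0 < x) (α : ℝ) :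
    x ^ (α + 2) = x ^ (α + 1) * x := by
  rw [show α + 2 = α + 1 + 1 by ring, Real.rpow_add_one hx.ne']

/-- The asymmetric tripole `z₁ = 1`, `z₂ = 0`, `z₃ = −a` with circulations
`πγ, −πγ(a/(a+1))^{α+1}, πγ a^{α+1}` is a stationary point vortex
configuration. -/
theorem tripole_is_stationary
    (α : ℝ) (hα : α ∈ Set.Ico (0 : ℝ) 1) (γ a : ℝ) (hγ : γ ≠ 0) (ha : a ∈ Set.Ioo (0 : ℝ) 1)
    (z₁ z₂ z₃ : ℂ) (γ₁ γ₂ γ₃ : ℝ)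
    (hz₁ : z₁ = 1) (hz₂ : z₂ = 0) (hz₃ : z₃ = -(a : ℂ))
    (hγ₁ : γ₁ = γ) (hγ₂ : γ₂ = -γ * (a / (a + 1)) ^ (α + 1)) (hγ₃ : γ₃ = γ * a ^ (α + 1)) :
    ((γ₂ : ℂ) * (z₁ - z₂) / ((‖z₁ - z₂‖ ^ (α + 2) : ℝ) : ℂ) +
      (γ₃ : ℂ) * (z₁ - z₃) / ((‖z₁ - z₃‖ ^ (α + 2) : ℝ) : ℂ) = 0) ∧
    ((γ₁ : ℂ) * (z₂ - z₁) / ((‖z₂ - z₁‖ ^ (α + 2) : ℝ) : ℂ) +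
      (γ₃ : ℂ) * (z₂ - z₃) / ((‖z₂ - z₃‖ ^ (α + 2) : ℝ) : ℂ) = 0) ∧
    ((γ₁ : ℂ) * (z₃ - z₁) / ((‖z₃ - z₁‖ ^ (α + 2) : ℝ) : ℂ) +
      (γ₂ : ℂ) * (z₃ - z₂) / ((‖z₃ - z₂‖ ^ (α + 2) : ℝ) : ℂ) = 0) := by
  subst hz₁ hz₂ hz₃ hγ₁ hγ₂ hγ₃
  obtain ⟨ha₀, -⟩ := ha
  have hb₀ : 0 < a + 1 := by linarith
  have norm_one_add : ‖(1 : ℂ) - -(a : ℂ)‖ = a + 1 := by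
    rw [show (1 : ℂ) - -(a : ℂ) = ((a + 1 : ℝ) : ℂ) by push_cast; ring,
      Complex.norm_of_nonneg hb₀.le]
  have norm_a : ‖(0 : ℂ) - -(a : ℂ)‖ = a := by simp [abs_of_pos ha₀]
  have norm_one : ‖(1 : ℂ) - 0‖ = 1 := by simp
  rw [norm_sub_rev 0 1, norm_sub_rev (-(a : ℂ)) 1, norm_sub_rev (-(a : ℂ)) 0,
    norm_one, norm_one_add, norm_a, Real.one_rpow, Real.div_rpow ha₀.le hb₀.le,
    rpow_add_two_eq_rpow_add_one_mul ha₀, rpow_add_two_eq_rpow_add_one_mul hb₀]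
  have hpa : ((a ^ (α + 1) : ℝ) : ℂ) ≠ 0 := mod_cast (Real.rpow_pos_of_pos ha₀ _).ne'
  have hpb : (((a + 1) ^ (α + 1) : ℝ) : ℂ) ≠ 0 := mod_cast (Real.rpow_pos_of_pos hb₀ _).ne'
  have ha' : (a : ℂ) ≠ 0 := mod_cast ha₀.ne'
  have hb' : (a : ℂ) + 1 ≠ 0 := mod_cast hb₀.ne'
  generalize a ^ (α + 1) = p at *
  generalize (a + 1) ^ (α + 1) = q at *
  push_cast
  refine ⟨?_, ?_, ?_⟩ <;> field_simp <;> ring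
end

section
/- Let α ∈ [0,1), γ ∈ ℝ \ {0}, d > 0, and c ∈ ℝ with 0 < |c| < 1, and set Ω* := γ Ĉ_α / (2 d^{α+2} (1+c)^{α+1}). Define Φ : ℝ³ → ℝ⁴ on a neighborhood of (d, −c·d, 0) by Φ(x₁, x₂, y₂) := (Re P₁, Im P₁, Re P₂, Im P₂), where z₁ := x₁, z₂ := x₂ + i y₂, P₁ := Ω* z₁ − (Ĉ_α/2) γ (z₁ − z₂)/|z₁ − z₂|^{α+2}, and P₂ := Ω* z₂ − (Ĉ_α/2) c γ (z₂ − z₁)/|z₂ − z₁|^{α+2}. Then Φ is differentiable at (d, −c·d, 0), and its Fréchet derivative there, a linear map ℝ³ → ℝ⁴, is injective and has range of codimension 1 in ℝ⁴ (i.e. rank 3). In particular the asymmetric co-rotating pair is a non-degenerate relative equilibrium. -/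
/-- The constant `Ĉ_α = 2^α Γ(1+α/2)/Γ(1−α/2)` of the gSQG point vortex model. -/
noncomputable def Chat (α : ℝ) : ℝ :=
  2 ^ α * Real.Gamma (1 + α / 2) / Real.Gamma (1 - α / 2)

open ContinuousLinearMap in
/-- At a point of the half-axis `u > 0`, `y = 0`, the function `(u² + y²) ^ (-p / 2)` of
`u = v 0 - v 1` and `y = v 2` has the derivative of `u ^ (-p)`. -/
theorem hasFDerivAt_distSq_rpow (p : ℝ) (v : Fin 3 → ℝ) (h2 : v 2 = 0) (hr : 0 < v 0 - v 1) :
    HasFDerivAt (fun w : Fin 3 → ℝ => ((w 0 - w 1) ^ 2 + w 2 ^ 2) ^ (-(p / 2)))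
      ((-(p * ((v 0 - v 1) ^ p)⁻¹ / (v 0 - v 1))) •
        ((proj 0 : (Fin 3 → ℝ) →L[ℝ] ℝ) - proj 1)) v := by
  have hp (i : Fin 3) : HasFDerivAt (fun w : Fin 3 → ℝ => w i)
      (proj i : (Fin 3 → ℝ) →L[ℝ] ℝ) v := hasFDerivAt_apply i v
  have hs : (v 0 - v 1) ^ 2 + v 2 ^ 2 ≠ 0 := by rw [h2]; positivity
  have h := ((((hp 0).fun_sub (hp 1)).pow 2).fun_add ((hp 2).pow 2)).rpow_const
    (p := -(p / 2)) (Or.inl hs)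
  refine h.congr_fderiv ?_
  have e : ((v 0 - v 1) ^ 2 + v 2 ^ 2) ^ (-(p / 2) - 1) =
      ((v 0 - v 1) ^ p)⁻¹ / (v 0 - v 1) ^ 2 := by
    rw [h2, zero_pow two_ne_zero, add_zero, ← Real.rpow_natCast (v 0 - v 1) 2,
      ← Real.rpow_mul hr.le, ← Real.rpow_neg hr.le, ← Real.rpow_sub hr]
    congr 1
    push_cast
    ring
  ext w
  simp only [e]
  simp [h2]
  field_simp

theorem norm_rpow_inv_eq (z : ℂ) (p : ℝ) :
    (‖z‖ ^ p)⁻¹ = (z.re ^ 2 + z.im ^ 2) ^ (-(p / 2)) := by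
  have h : 0 ≤ z.re ^ 2 + z.im ^ 2 := by positivity
  rw [Real.rpow_neg h, Real.rpow_div_two_eq_sqrt p h, Complex.norm_eq_sqrt_sq_add_sq]

theorem Chat_ne_zero {α : ℝ} (hα : α ∈ Set.Ico (0 : ℝ) 1) : Chat α ≠ 0 := by
  have h1 : 0 < Real.Gamma (1 + α / 2) := Real.Gamma_pos_of_pos (by linarith [hα.1])
  have h2 : 0 < Real.Gamma (1 - α / 2) := Real.Gamma_pos_of_pos (by linarith [hα.2])
  unfold Chat
  positivity

/-- The angular velocity in terms of the separation `d (1 + c)` of the vortices. -/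
theorem angularVelocity_eq {d c : ℝ} (α K : ℝ) (hd : 0 < d) (hc : 0 < 1 + c) :
    K / (d ^ (α + 2) * (1 + c) ^ (α + 1)) = K * ((d * (1 + c)) ^ (α + 2))⁻¹ * (1 + c) := by
  have h : (1 + c) ^ (α + 2) = (1 + c) ^ (α + 1) * (1 + c) := by
    rw [← Real.rpow_add_one hc.ne']
    ring_nf
  rw [Real.mul_rpow hd.le hc.le, h]
  field_simp

/-- The codomain of an injective linear map modulo its range has the complementary dimension. -/
theorem finrank_quotient_range_of_injective {E F : Type*} [AddCommGroup E] [Module ℝ E]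
    [AddCommGroup F] [Module ℝ F] [FiniteDimensional ℝ F] (f : E →ₗ[ℝ] F)
    (hf : Function.Injective f) :
    Module.finrank ℝ (F ⧸ LinearMap.range f) = Module.finrank ℝ F - Module.finrank ℝ E := by
  rw [Submodule.finrank_quotient, LinearMap.finrank_range_of_inj hf]

open ContinuousLinearMap in
/-- The derivative of the residual map at a collinear configuration, in terms of the angular
velocity `Ω`, the strength `K`, the ratio `c`, and the values `G` and `A` at the separation of the
derivatives of `y ↦ y g` and `u ↦ u g`, where `g` is the inverse power of the distance. -/
noncomputable def residualDeriv (Ω K c G A : ℝ) : (Fin 3 → ℝ) →L[ℝ] (Fin 4 → ℝ) :=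
  let x (i : Fin 3) : (Fin 3 → ℝ) →L[ℝ] ℝ := proj i
  ContinuousLinearMap.pi ![
    Ω • x 0 - (K * A) • (x 0 - x 1),
    (K * G) • x 2,
    Ω • x 1 + (c * K * A) • (x 0 - x 1),
    (Ω - c * K * G) • x 2]

theorem residualDeriv_injective {Ω K c G A : ℝ} (hKG : K * G ≠ 0) (hΩ : Ω ≠ 0)
    (h : Ω - K * A * (1 + c) ≠ 0) : Function.Injective (residualDeriv Ω K c G A) := by
  rw [injective_iff_map_eq_zero]
  intro v hv
  have e0 : Ω * v 0 - K * A * (v 0 - v 1) = 0 := by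
    simpa [residualDeriv] using congrFun hv 0
  have e1 : K * G * v 2 = 0 := by
    simpa [residualDeriv] using congrFun hv 1
  have e2 : Ω * v 1 + c * K * A * (v 0 - v 1) = 0 := by
    simpa [residualDeriv] using congrFun hv 2
  have hu : v 0 - v 1 = 0 :=
    (mul_eq_zero.1 (show (Ω - K * A * (1 + c)) * (v 0 - v 1) = 0 by
      linear_combination e0 - e2)).resolve_left h
  have h0 : v 0 = 0 := (mul_eq_zero.1 (show Ω * v 0 = 0 by
    linear_combination e0 + K * A * hu)).resolve_left hΩ
  have h1 : v 1 = 0 := by linarith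
  have h2 : v 2 = 0 := (mul_eq_zero.1 e1).resolve_left hKG
  ext i
  fin_cases i
  exacts [h0, h1, h2]

/-- The residual map is differentiable at a collinear configuration with `v 0 > v 1`. -/
theorem hasFDerivAt_residual (Ω K c p : ℝ) (v : Fin 3 → ℝ) (h2 : v 2 = 0)
    (hr : 0 < v 0 - v 1) :
    HasFDerivAt (fun w : Fin 3 → ℝ =>
        let g := ((w 0 - w 1) ^ 2 + w 2 ^ 2) ^ (-(p / 2))
        (![Ω * w 0 - K * ((w 0 - w 1) * g), K * (w 2 * g),
          Ω * w 1 + c * K * ((w 0 - w 1) * g), Ω * w 2 - c * K * (w 2 * g)] : Fin 4 → ℝ))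
      (residualDeriv Ω K c (((v 0 - v 1) ^ p)⁻¹) ((1 - p) * ((v 0 - v 1) ^ p)⁻¹)) v := by
  have hp (i : Fin 3) : HasFDerivAt (fun w : Fin 3 → ℝ => w i)
      (ContinuousLinearMap.proj i : (Fin 3 → ℝ) →L[ℝ] ℝ) v := hasFDerivAt_apply i v
  have hg := hasFDerivAt_distSq_rpow p v h2 hr
  have e : ((v 0 - v 1) ^ 2 + v 2 ^ 2) ^ (-(p / 2)) = ((v 0 - v 1) ^ p)⁻¹ := by
    have h := norm_rpow_inv_eq ((v 0 - v 1 : ℝ) : ℂ) p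
    rw [Complex.norm_real, Real.norm_of_nonneg hr.le, Complex.ofReal_re, Complex.ofReal_im] at h
    rw [h2, h]
  have hug := ((hp 0).fun_sub (hp 1)).fun_mul hg
  have hyg := (hp 2).fun_mul hg
  rw [e] at hug hyg
  rw [hasFDerivAt_pi']
  intro i
  fin_cases i
  · refine (((hp 0).const_mul Ω).fun_sub (hug.const_mul K)).congr_fderiv ?_
    ext w
    simp [residualDeriv]
    field_simp
    ring
  · refine (hyg.const_mul K).congr_fderiv ?_
    ext w
    simp [residualDeriv, h2]
    ring
  · refine (((hp 1).const_mul Ω).fun_add (hug.const_mul (c * K))).congr_fderiv ?_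
    ext w
    simp [residualDeriv]
    field_simp
    ring
  · refine (((hp 2).const_mul Ω).fun_sub (hyg.const_mul (c * K))).congr_fderiv ?_
    ext w
    simp [residualDeriv, h2]
    ring

/-- Non-degeneracy of the asymmetric co-rotating pair: the map collecting the
real and imaginary parts of the residuals `P₁, P₂`, as a function of the free
coordinates `(x₁, x₂, y₂)`, is differentiable at `(d, −cd, 0)` with injective
derivative whose range has codimension 1 in `ℝ⁴`. -/
theorem corotating_pair_nondegenerate
    (α : ℝ) (hα : α ∈ Set.Ico (0 : ℝ) 1) (γ d c : ℝ) (hγ : γ ≠ 0) (hd : 0 < d)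
    (hc0 : 0 < |c|) (hc1 : |c| < 1)
    (Ω : ℝ) (hΩ : Ω = γ * Chat α / (2 * d ^ (α + 2) * (1 + c) ^ (α + 1)))
    (Φ : (Fin 3 → ℝ) → (Fin 4 → ℝ))
    (hΦ : ∀ v : Fin 3 → ℝ,
      Φ v =
        let z₁ : ℂ := (v 0 : ℂ)
        let z₂ : ℂ := (v 1 : ℂ) + (v 2 : ℂ) * Complex.I
        let P₁ : ℂ := (Ω : ℂ) * z₁ - ((Chat α / 2 : ℝ) : ℂ) *
          ((γ : ℂ) * (z₁ - z₂) / ((‖z₁ - z₂‖ ^ (α + 2) : ℝ) : ℂ))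
        let P₂ : ℂ := (Ω : ℂ) * z₂ - ((Chat α / 2 : ℝ) : ℂ) *
          (((c * γ : ℝ) : ℂ) * (z₂ - z₁) / ((‖z₂ - z₁‖ ^ (α + 2) : ℝ) : ℂ))
        ![P₁.re, P₁.im, P₂.re, P₂.im]) :
    ∃ Der : (Fin 3 → ℝ) →L[ℝ] (Fin 4 → ℝ),
      HasFDerivAt Φ Der ![d, -(c * d), 0] ∧
      Function.Injective Der ∧
      Module.finrank ℝ
        ((Fin 4 → ℝ) ⧸ LinearMap.range (Der : (Fin 3 → ℝ) →ₗ[ℝ] (Fin 4 → ℝ))) = 1 := by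
  obtain ⟨hcl, -⟩ := abs_lt.1 hc1
  have hc : 0 < 1 + c := by linarith
  have hr : 0 < d * (1 + c) := mul_pos hd hc
  set K := Chat α / 2 * γ with hK
  have hK0 : K ≠ 0 := mul_ne_zero (div_ne_zero (Chat_ne_zero hα) two_ne_zero) hγ
  set G := ((d * (1 + c)) ^ (α + 2))⁻¹ with hG
  have hG0 : G ≠ 0 := by positivity
  have hΩG : Ω = K * G * (1 + c) := by
    rw [hΩ, hG, ← angularVelocity_eq α K hd hc, hK]
    field_simp
  have hΦ' : Φ = fun w : Fin 3 → ℝ =>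
      let g := ((w 0 - w 1) ^ 2 + w 2 ^ 2) ^ (-((α + 2) / 2))
      (![Ω * w 0 - K * ((w 0 - w 1) * g), K * (w 2 * g),
        Ω * w 1 + c * K * ((w 0 - w 1) * g), Ω * w 2 - c * K * (w 2 * g)] : Fin 4 → ℝ) := by
    funext w
    have hg := norm_rpow_inv_eq ((w 0 : ℂ) - (w 1 + w 2 * Complex.I)) (α + 2)
    simp only [Complex.sub_re, Complex.sub_im, Complex.add_re, Complex.add_im, Complex.ofReal_re,
      Complex.ofReal_im, Complex.re_ofReal_mul, Complex.im_ofReal_mul, Complex.I_re, Complex.I_im,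
      mul_zero, mul_one, add_zero, zero_add, zero_sub, neg_sq] at hg
    rw [hΦ]
    simp only [← hg]
    simp only [norm_sub_rev ((w 1 : ℂ) + w 2 * Complex.I), div_eq_mul_inv,
      ← Complex.ofReal_inv]
    ext i
    fin_cases i <;> simp [hK] <;> ring
  have hv : (![d, -(c * d), 0] : Fin 3 → ℝ) 0 - ![d, -(c * d), 0] 1 = d * (1 + c) := by
    simp
    ring
  have hD := hasFDerivAt_residual Ω K c (α + 2) ![d, -(c * d), 0] rfl (hv ▸ hr)
  rw [hv, ← hG] at hD
  have hinj : Function.Injective (residualDeriv Ω K c G ((1 - (α + 2)) * G)) := by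
    refine residualDeriv_injective (mul_ne_zero hK0 hG0) ?_ ?_
    · rw [hΩG]
      exact mul_ne_zero (mul_ne_zero hK0 hG0) hc.ne'
    · have h : Ω - K * ((1 - (α + 2)) * G) * (1 + c) = K * G * (1 + c) * (α + 2) := by
        rw [hΩG]
        ring
      rw [h]
      exact mul_ne_zero (mul_ne_zero (mul_ne_zero hK0 hG0) hc.ne') (by linarith [hα.1])
  refine ⟨_, hΦ' ▸ hD, hinj, ?_⟩
  rw [finrank_quotient_range_of_injective _ hinj]
  simp
end

section
/- Let α ∈ [0,1), γ ∈ ℝ \ {0}, and d > 0, and set U* := γ Ĉ_α / (2^{α+2} d^{α+1}). Define Φ : ℝ³ → ℝ⁴ on a neighborhood of (−d, 0, −γ) by Φ(x₂, y₂, γ₁) := (Re P₁, Im P₁, Re P₂, Im P₂), where z₁ := d, z₂ := x₂ + i y₂, P₁ := U* − (Ĉ_α/2) γ (z₁ − z₂)/|z₁ − z₂|^{α+2}, and P₂ := U* − (Ĉ_α/2) γ₁ (z₂ − z₁)/|z₂ − z₁|^{α+2}. Then Φ is differentiable at (−d, 0, −γ), and its Fréchet derivative there, a linear map ℝ³ →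 ℝ⁴, is injective and has range of codimension 1 in ℝ⁴ (i.e. rank 3). In particular the counter-rotating pair is a non-degenerate translating equilibrium. -/
lemma Chat_pos {α : ℝ} (hα : α ∈ Set.Ico (0 : ℝ) 1) : 0 < Chat α := by
  obtain ⟨h0, h1⟩ := hα
  have hn : 0 < Real.Gamma (1 + α / 2) := Real.Gamma_pos_of_pos (by linarith)
  have hm : 0 < Real.Gamma (1 - α / 2) := Real.Gamma_pos_of_pos (by linarith)
  unfold Chat
  positivity

lemma norm_rpow_eq_sq_add_sq_rpow (z : ℂ) (p : ℝ) :
    ‖z‖ ^ p = (z.re ^ 2 + z.im ^ 2) ^ (p / 2) := by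
  rw [show z.re ^ 2 + z.im ^ 2 = ‖z‖ ^ 2 by rw [Complex.sq_norm, Complex.normSq_apply]; ring,
    ← Real.rpow_natCast, ← Real.rpow_mul (norm_nonneg z)]
  congr 1
  push_cast
  ring

/-- The derivative of the inverse power `|z₁ - z₂|^(-p)` of the separation of the two vortices
at the symmetric configuration. -/
lemma hasFDerivAt_separation_rpow {d : ℝ} (hd : 0 < d) (c p : ℝ) :
    HasFDerivAt (fun v : Fin 3 → ℝ => ((d - v 0) ^ 2 + v 1 ^ 2) ^ (-(p / 2)))
      ((((2 * d) ^ 2) ^ (-(p / 2)) * (p / (2 * d))) •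
        (ContinuousLinearMap.proj 0 : (Fin 3 → ℝ) →L[ℝ] ℝ)) ![-d, 0, c] := by
  have e0 : HasFDerivAt (fun v : Fin 3 → ℝ => v 0)
      (ContinuousLinearMap.proj 0 : (Fin 3 → ℝ) →L[ℝ] ℝ) ![-d, 0, c] := hasFDerivAt_apply 0 _
  have e1 : HasFDerivAt (fun v : Fin 3 → ℝ => v 1)
      (ContinuousLinearMap.proj 1 : (Fin 3 → ℝ) →L[ℝ] ℝ) ![-d, 0, c] := hasFDerivAt_apply 1 _
  have hs : (d - (![-d, 0, c] : Fin 3 → ℝ) 0) ^ 2 + (![-d, 0, c] : Fin 3 → ℝ) 1 ^ 2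
      = (2 * d) ^ 2 := by
    simp
    ring
  have h := (((e0.const_sub d).pow 2).add (e1.pow 2)).rpow_const (p := -(p / 2))
    (Or.inl (by simp only [Pi.add_apply]; rw [hs]; positivity))
  refine h.congr_fderiv ?_
  ext v
  simp only [Pi.add_apply, hs]
  rw [Real.rpow_sub_one (by positivity)]
  simp
  field_simp
  ring

/-- Non-degeneracy of the counter-rotating pair: the map collecting the real
and imaginary parts of the residuals `P₁, P₂`, as a function of the free
coordinates `(x₂, y₂, γ₁)`, is differentiable at `(−d, 0, −γ)` with injective
derivative whose range has codimension 1 in `ℝ⁴`. -/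
theorem counterrotating_pair_nondegenerate
    (α : ℝ) (hα : α ∈ Set.Ico (0 : ℝ) 1) (γ d : ℝ) (hγ : γ ≠ 0) (hd : 0 < d)
    (U : ℝ) (hU : U = γ * Chat α / (2 ^ (α + 2) * d ^ (α + 1)))
    (Φ : (Fin 3 → ℝ) → (Fin 4 → ℝ))
    (hΦ : ∀ v : Fin 3 → ℝ,
      Φ v =
        let z₁ : ℂ := (d : ℂ)
        let z₂ : ℂ := (v 0 : ℂ) + (v 1 : ℂ) * Complex.I
        let P₁ : ℂ := (U : ℂ) - ((Chat α / 2 : ℝ) : ℂ) *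
          ((γ : ℂ) * (z₁ - z₂) / ((‖z₁ - z₂‖ ^ (α + 2) : ℝ) : ℂ))
        let P₂ : ℂ := (U : ℂ) - ((Chat α / 2 : ℝ) : ℂ) *
          ((v 2 : ℂ) * (z₂ - z₁) / ((‖z₂ - z₁‖ ^ (α + 2) : ℝ) : ℂ))
        ![P₁.re, P₁.im, P₂.re, P₂.im]) :
    ∃ Der : (Fin 3 → ℝ) →L[ℝ] (Fin 4 → ℝ),
      HasFDerivAt Φ Der ![-d, 0, -γ] ∧
      Function.Injective Der ∧
      Module.finrank ℝ
        ((Fin 4 → ℝ) ⧸ LinearMap.range (Der : (Fin 3 → ℝ) →ₗ[ℝ] (Fin 4 → ℝ))) = 1 := by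
  have hC : 0 < Chat α := Chat_pos hα
  set q : (Fin 3 → ℝ) → ℝ := fun v => ((d - v 0) ^ 2 + v 1 ^ 2) ^ (-((α + 2) / 2)) with hq
  set G : ℝ := ((2 * d) ^ 2) ^ (-((α + 2) / 2)) with hG
  have hGpos : 0 < G := by positivity
  have hα1 : 0 < α + 1 := by linarith [hα.1]
  obtain rfl : Φ = fun v => ![U - Chat α / 2 * (γ * (d - v 0) * q v),
      Chat α / 2 * (γ * v 1 * q v),
      U + Chat α / 2 * (v 2 * (d - v 0) * q v),
      -(Chat α / 2 * (v 2 * v 1 * q v))] := by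
    funext v
    have hn : ‖(d : ℂ) - ((v 0 : ℂ) + (v 1 : ℂ) * Complex.I)‖ ^ (α + 2) = (q v)⁻¹ := by
      rw [norm_rpow_eq_sq_add_sq_rpow, hq]
      simp only [Real.rpow_neg (by positivity : 0 ≤ (d - v 0) ^ 2 + v 1 ^ 2), inv_inv]
      simp
    have hn' : ‖((v 0 : ℂ) + (v 1 : ℂ) * Complex.I) - (d : ℂ)‖ ^ (α + 2) = (q v)⁻¹ := by
      rw [norm_sub_rev, hn]
    rw [hΦ]
    simp only [hn, hn', div_eq_mul_inv, ← Complex.ofReal_inv, inv_inv]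
    ext i
    fin_cases i <;> simp <;> ring
  have e0 : HasFDerivAt (fun v : Fin 3 → ℝ => v 0)
      (ContinuousLinearMap.proj 0 : (Fin 3 → ℝ) →L[ℝ] ℝ) ![-d, 0, -γ] := hasFDerivAt_apply 0 _
  have e1 : HasFDerivAt (fun v : Fin 3 → ℝ => v 1)
      (ContinuousLinearMap.proj 1 : (Fin 3 → ℝ) →L[ℝ] ℝ) ![-d, 0, -γ] := hasFDerivAt_apply 1 _
  have e2 : HasFDerivAt (fun v : Fin 3 → ℝ => v 2)
      (ContinuousLinearMap.proj 2 : (Fin 3 → ℝ) →L[ℝ] ℝ) ![-d, 0, -γ] := hasFDerivAt_apply 2 _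
  have eq : HasFDerivAt q ((G * ((α + 2) / (2 * d))) •
      (ContinuousLinearMap.proj 0 : (Fin 3 → ℝ) →L[ℝ] ℝ)) ![-d, 0, -γ] :=
    hasFDerivAt_separation_rpow hd _ _
  have hqG : q ![-d, 0, -γ] = G := by
    simp [hq, hG]
    ring_nf
  let Der : (Fin 3 → ℝ) →L[ℝ] (Fin 4 → ℝ) := ContinuousLinearMap.pi
    ![(-(Chat α / 2 * γ * (α + 1) * G)) • ContinuousLinearMap.proj 0,
      (Chat α / 2 * γ * G) • ContinuousLinearMap.proj 1,
      (-(Chat α / 2 * γ * (α + 1) * G)) • ContinuousLinearMap.proj 0 +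
        (Chat α / 2 * (2 * d) * G) • ContinuousLinearMap.proj 2,
      (Chat α / 2 * γ * G) • ContinuousLinearMap.proj 1]
  have hinj : Function.Injective Der := by
    rw [injective_iff_map_eq_zero]
    intro v hv
    have h0 := congrFun hv 0
    have h1 := congrFun hv 1
    have h2 := congrFun hv 2
    simp [Der, hC.ne', hγ, hGpos.ne', hα1.ne'] at h0 h1 h2
    simp [h0, hC.ne', hGpos.ne', hd.ne'] at h2
    ext i
    fin_cases i <;> simp [h0, h1, h2]
  refine ⟨Der, ?_, hinj, ?_⟩
  · rw [hasFDerivAt_pi']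
    intro i
    fin_cases i
    · refine (((((e0.const_sub d).const_mul γ).mul eq).const_mul
        (Chat α / 2)).const_sub U).congr_fderiv ?_
      ext v
      simp [Der, hqG]
      field_simp
      ring
    · refine (((e1.const_mul γ).mul eq).const_mul (Chat α / 2)).congr_fderiv ?_
      ext v
      simp [Der, hqG]
      ring
    · refine ((((e2.mul (e0.const_sub d)).mul eq).const_mul
        (Chat α / 2)).const_add U).congr_fderiv ?_
      ext v
      simp [Der, hqG]
      field_simp
      ring
    · refine (((e2.mul e1).mul eq).const_mul (Chat α / 2)).neg.congr_fderiv ?_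
      ext v
      simp [Der, hqG]
      ring
  · have hr := LinearMap.finrank_range_of_inj
      (f := (Der : (Fin 3 → ℝ) →ₗ[ℝ] (Fin 4 → ℝ))) hinj
    have hs := Submodule.finrank_quotient_add_finrank
      (LinearMap.range (Der : (Fin 3 → ℝ) →ₗ[ℝ] (Fin 4 → ℝ)))
    rw [hr] at hs
    simp only [Module.finrank_fin_fun] at hs
    omega
end

section
/- Let α ∈ [0,1), let m ≥ 2 be an integer, let ϑ ∈ {0,1}, let d₂ > d₁ > 0, let γ₀, γ₁, γ₂ ∈ ℝ, and let Ω ∈ ℝ. Consider the 2m+1 points w₀ := 0, w_{1,k} := d₁ e^{2kπi/m}, and w_{2,k} := d₂ e^{i(2k+ϑ)π/m} for 0 ≤ k ≤ m−1 (these are pairwise distinct), carrying circulations πγ₀ at w₀ and πγ_j at w_{j,k}, and for each point w of the configuration define P(w) := Ω w − (Ĉ_α/2) ∑_{w'≠w} γ(w') (w − w')/|w − w'|^{α+2}, the sum running over the other 2m points w' with their circulations πγ(w'). Then: (a) the center equation holds automatically, P(w₀) = 0; and (b) for each j ∈ {1,2} and each 0 ≤ k ≤ m−1, P(w_{j,k})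 = e^{2kπi/m} · P(w_{j,0}). Consequently, the configuration is a relative equilibrium rotating with angular velocity Ω if and only if P(w_{1,0}) = 0 and P(w_{2,0}) = 0. -/
open Finset

/-- Summing a function of `η ^ k` over a full period is invariant under `k ↦ k + 1`. -/
theorem sum_fin_pow_mul {m : ℕ} {η : ℂ} (hη : η ^ m = 1) (f : ℂ → ℂ) :
    ∑ k : Fin m, f (η * η ^ (k : ℕ)) = ∑ k : Fin m, f (η ^ (k : ℕ)) := by
  rw [Fin.sum_univ_eq_sum_range (fun k => f (η * η ^ k)) m,
    Fin.sum_univ_eq_sum_range (fun k => f (η ^ k)) m]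
  have h := (Finset.sum_range_succ (fun k => f (η ^ k)) m).symm.trans
    (Finset.sum_range_succ' (fun k => f (η ^ k)) m)
  simp only [hη, pow_zero, pow_succ'] at h
  exact (add_right_cancel h).symm

/-- The velocity induced at `ζ` by a vortex at `z` is equivariant under rotations. -/
theorem vortex_kernel_rotate {η : ℂ} (hη : ‖η‖ = 1) (s : ℝ) (c ζ z : ℂ) :
    (if η * z ≠ η * ζ then
      c * (η * ζ - η * z) / ((‖η * ζ - η * z‖ ^ s : ℝ) : ℂ) else 0) =
    η * (if z ≠ ζ then c * (ζ - z) / ((‖ζ - z‖ ^ s : ℝ) : ℂ) else 0) := by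
  have h0 : η ≠ 0 := norm_ne_zero_iff.mp (by rw [hη]; exact one_ne_zero)
  have hn : ‖η * ζ - η * z‖ = ‖ζ - z‖ := by rw [← mul_sub, norm_mul, hη, one_mul]
  rw [hn]
  by_cases h : z = ζ
  · simp [h]
  · rw [if_pos (fun e => h (mul_left_cancel₀ h0 e)), if_pos h]
    ring

/-- A central vortex together with two nested regular `m`-gons: the `2m+1`
points are pairwise distinct, the center equation holds automatically, the
residuals on each polygon are rotations of the residual at the first vertex,
and hence the configuration is a relative equilibrium rotating with angular
velocity `Ω` iff the two reduced equations `P(w_{1,0}) = P(w_{2,0}) = 0` hold. -/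
theorem nested_polygon_reduction
    (α : ℝ) (hα : α ∈ Set.Ico (0 : ℝ) 1) (m : ℕ) (hm : 2 ≤ m)
    (ϑ : ℕ) (hϑ : ϑ = 0 ∨ ϑ = 1) (d₁ d₂ : ℝ) (h1 : 0 < d₁) (h12 : d₁ < d₂)
    (γ₀ : ℝ) (γ : Fin 2 → ℝ) (Ω : ℝ)
    (w : Fin 2 → Fin m → ℂ)
    (hw1 : ∀ k : Fin m,
      w 0 k = (d₁ : ℂ) * Complex.exp (2 * ((k : ℕ) : ℂ) * (Real.pi : ℂ) * Complex.I / (m : ℂ)))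
    (hw2 : ∀ k : Fin m,
      w 1 k = (d₂ : ℂ) *
        Complex.exp ((2 * ((k : ℕ) : ℂ) + (ϑ : ℂ)) * (Real.pi : ℂ) * Complex.I / (m : ℂ)))
    (P : ℂ → ℂ)
    (hP : ∀ ζ : ℂ, P ζ = (Ω : ℂ) * ζ - ((Chat α / 2 : ℝ) : ℂ) *
        ((if ζ ≠ 0 then (γ₀ : ℂ) * (ζ - 0) / ((‖ζ - 0‖ ^ (α + 2) : ℝ) : ℂ) else 0) +
          ∑ j : Fin 2, ∑ k : Fin m,
            if w j k ≠ ζ then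
              (γ j : ℂ) * (ζ - w j k) / ((‖ζ - w j k‖ ^ (α + 2) : ℝ) : ℂ)
            else 0)) :
    (∀ j k, w j k ≠ 0) ∧
    (∀ j k j' k', w j k = w j' k' → j = j' ∧ k = k') ∧
    P 0 = 0 ∧
    (∀ (j : Fin 2) (k : Fin m),
      P (w j k) = Complex.exp (2 * ((k : ℕ) : ℂ) * (Real.pi : ℂ) * Complex.I / (m : ℂ)) *
        P (w j ⟨0, by omega⟩)) ∧
    ((P 0 = 0 ∧ ∀ j k, P (w j k) = 0) ↔
      (P (w 0 ⟨0, by omega⟩) = 0 ∧ P (w 1 ⟨0, by omega⟩) = 0)) := by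
  have hm0 : m ≠ 0 := by omega
  set η : ℂ := Complex.exp (2 * Real.pi * Complex.I / m) with hη
  have hprim : IsPrimitiveRoot η m := Complex.isPrimitiveRoot_exp m hm0
  have hη1 : ‖η‖ = 1 := hprim.norm'_eq_one hm0
  have hexp (k : ℕ) :
      Complex.exp (2 * (k : ℂ) * (Real.pi : ℂ) * Complex.I / (m : ℂ)) = η ^ k := by
    rw [hη, ← Complex.exp_nat_mul]
    congr 1
    ring
  obtain ⟨a, ha, hna0, hna1⟩ : ∃ a : Fin 2 → ℂ,
      (∀ j (k : Fin m), w j k = a j * η ^ (k : ℕ)) ∧ ‖a 0‖ = d₁ ∧ ‖a 1‖ = d₂ := by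
    refine ⟨![(d₁ : ℂ), (d₂ : ℂ) * Complex.exp (((ϑ * Real.pi / m : ℝ) : ℂ) * Complex.I)],
      ?_, ?_, ?_⟩
    · intro j k
      fin_cases j
      · simpa [hexp] using hw1 k
      · have h := hw2 k
        rw [show (2 * ((k : ℕ) : ℂ) + (ϑ : ℂ)) * (Real.pi : ℂ) * Complex.I / (m : ℂ) =
          ((ϑ * Real.pi / m : ℝ) : ℂ) * Complex.I +
            2 * ((k : ℕ) : ℂ) * (Real.pi : ℂ) * Complex.I / (m : ℂ) by push_cast; ring,
          Complex.exp_add, hexp, ← mul_assoc] at h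
        exact h
    · simp [abs_of_pos h1]
    · simp only [Matrix.cons_val_one, Matrix.cons_val_fin_one, norm_mul,
        Complex.norm_exp_ofReal_mul_I, Complex.norm_real, Real.norm_eq_abs, mul_one]
      exact abs_of_pos (h1.trans h12)
  have hnw (j) (k : Fin m) : ‖w j k‖ = ‖a j‖ := by rw [ha, norm_mul, norm_pow, hη1]; simp
  have ha0 : ∀ j, a j ≠ 0 := by
    refine Fin.forall_fin_two.mpr ⟨?_, ?_⟩ <;> rw [← norm_pos_iff] <;> linarith
  have hrot (ζ : ℂ) : P (η * ζ) = η * P ζ := by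
    have hsum (j : Fin 2) :
        (∑ k : Fin m, if w j k ≠ η * ζ then
          (γ j : ℂ) * (η * ζ - w j k) / ((‖η * ζ - w j k‖ ^ (α + 2) : ℝ) : ℂ) else 0) =
        η * ∑ k : Fin m, if w j k ≠ ζ then
          (γ j : ℂ) * (ζ - w j k) / ((‖ζ - w j k‖ ^ (α + 2) : ℝ) : ℂ) else 0 := by
      rw [Finset.mul_sum]
      refine Eq.trans ?_ (Finset.sum_congr rfl fun k _ =>
        vortex_kernel_rotate hη1 (α + 2) (γ j : ℂ) ζ (w j k))
      have h := sum_fin_pow_mul hprim.pow_eq_one (fun x =>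
        if a j * x ≠ η * ζ then
          (γ j : ℂ) * (η * ζ - a j * x) / ((‖η * ζ - a j * x‖ ^ (α + 2) : ℝ) : ℂ) else 0)
      simp only [mul_left_comm (a j) η, ← ha] at h
      exact h.symm
    have hcenter : (if η * ζ ≠ 0 then
          (γ₀ : ℂ) * (η * ζ - 0) / ((‖η * ζ - 0‖ ^ (α + 2) : ℝ) : ℂ) else 0) =
        η * (if ζ ≠ 0 then (γ₀ : ℂ) * (ζ - 0) / ((‖ζ - 0‖ ^ (α + 2) : ℝ) : ℂ) else 0) := by
      have h := vortex_kernel_rotate hη1 (α + 2) (γ₀ : ℂ) ζ 0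
      rw [mul_zero] at h
      by_cases hζ : ζ = 0
      · simp [hζ]
      · have hηζ := mul_ne_zero (hprim.ne_zero hm0) hζ
        rw [if_pos hηζ.symm, if_pos (Ne.symm hζ)] at h
        rw [if_pos hηζ, if_pos hζ, h]
    rw [hP, hP, hcenter, Finset.sum_congr rfl fun j _ => hsum j, ← Finset.mul_sum]
    ring
  have hrot_pow (k : ℕ) (ζ : ℂ) : P (ζ * η ^ k) = η ^ k * P ζ := by
    induction k with
    | zero => simp
    | succ k ih => rw [pow_succ', mul_left_comm, hrot, ih, mul_assoc]
  have hP0 : P 0 = 0 := by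
    have h := hrot 0
    rw [mul_zero] at h
    by_contra hne
    exact hprim.ne_one (by omega) (mul_right_cancel₀ hne (by rw [one_mul, ← h]))
  have hPw (j : Fin 2) (k : Fin m) : P (w j k) = η ^ (k : ℕ) * P (w j ⟨0, by omega⟩) := by
    rw [ha, ha, hrot_pow, pow_zero, mul_one]
  refine ⟨fun j k => ?_, fun j k j' k' h => ?_, hP0, fun j k => ?_, ?_⟩
  · rw [ha]
    exact mul_ne_zero (ha0 j) (pow_ne_zero _ (hprim.ne_zero hm0))
  · have hj : j = j' := by
      have hn := congrArg norm h
      rw [hnw, hnw] at hn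
      have hne : ‖a 0‖ ≠ ‖a 1‖ := by rw [hna0, hna1]; exact h12.ne
      clear h
      revert j j'
      simp only [Fin.forall_fin_two]
      simp [hne, hne.symm]
    subst hj
    rw [ha, ha] at h
    exact ⟨rfl, Fin.ext (hprim.pow_inj k.2 k'.2 (mul_left_cancel₀ (ha0 j) h))⟩
  · rw [hexp]
    exact hPw j k
  · refine ⟨fun h => ⟨h.2 _ _, h.2 _ _⟩, fun h => ⟨hP0, fun j k => ?_⟩⟩
    have h0 : ∀ j, P (w j ⟨0, by omega⟩) = 0 := Fin.forall_fin_two.mpr h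
    rw [hPw, h0, mul_zero]
end
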